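/- Let d be a positive integer, E ≥ 1 an integer, P_n, B, σ² ≥ 0, A ≥ 1, c ≥ 0, f : ℝ^d → ℝ differentiable, and w, w^0, …, w^{E−1} ∈ ℝ^d. Suppose vectors ζ^0, …, ζ^{E−1} ∈ ℝ^d satisfy ‖ζ^e‖² ≤ P_n·B²·‖∇f(w^e)‖² + σ² for every e, and that E·∑_{e=0}^{E−1} ‖∇f(w^e) − ∇f(w)‖² ≤ (2E²/A²)·( A·‖∇f(w)‖² + c ). Then ‖∑_{e=0}^{E−1} ζ^e‖² ≤ 2·P_n·B²·E²·(1 + 2/A)·‖∇f(w)‖² + E²·σ² + (4·P_n·B²·E²/A²)·c. -/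

import Mathlib

open Finset

/-- The squared norm of a sum is at most the number of terms times the sum of squared norms. -/
theorem norm_sum_sq_le_card_mul_sum_norm_sq {ι F : Type*} [SeminormedAddCommGroup F]
    (s : Finset ι) (v : ι → F) :
    ‖∑ i ∈ s, v i‖ ^ 2 ≤ (s.card : ℝ) * ∑ i ∈ s, ‖v i‖ ^ 2 :=
  (pow_le_pow_left₀ (norm_nonneg _) (norm_sum_le s v) 2).trans sq_sum_le_card_mul_sum_sq

theorem norm_sq_le_two_mul_norm_sub_sq_add {F : Type*} [SeminormedAddCommGroup F] (x y : F) :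
    ‖x‖ ^ 2 ≤ 2 * (‖x - y‖ ^ 2 + ‖y‖ ^ 2) :=
  (pow_le_pow_left₀ (norm_nonneg _) (norm_le_norm_sub_add x y) 2).trans add_sq_le

/-- aggregated-noise second-moment bound, analogue of equation (39). -/
theorem aggregated_noise_bound
    (d : ℕ) (hd : 0 < d)
    (E : ℕ) (hE : 1 ≤ E)
    (Pn B σsq : ℝ) (hPn : 0 ≤ Pn) (hB : 0 ≤ B) (hσsq : 0 ≤ σsq)
    (A : ℝ) (hA : 1 ≤ A)
    (c : ℝ) (hc : 0 ≤ c)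
    (f : EuclideanSpace ℝ (Fin d) → ℝ)
    (f' : EuclideanSpace ℝ (Fin d) → EuclideanSpace ℝ (Fin d))
    (hgrad : ∀ x, HasGradientAt f (f' x) x)
    (w : EuclideanSpace ℝ (Fin d))
    (wseq ζ : ℕ → EuclideanSpace ℝ (Fin d))
    (hζ : ∀ e ∈ Finset.range E, ‖ζ e‖ ^ 2 ≤ Pn * B ^ 2 * ‖f' (wseq e)‖ ^ 2 + σsq)
    (hdev : (E : ℝ) * ∑ e ∈ Finset.range E, ‖f' (wseq e) - f' w‖ ^ 2 ≤
      (2 * (E : ℝ) ^ 2 / A ^ 2) * (A * ‖f' w‖ ^ 2 + c)) :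
    ‖∑ e ∈ Finset.range E, ζ e‖ ^ 2 ≤
      2 * Pn * B ^ 2 * (E : ℝ) ^ 2 * (1 + 2 / A) * ‖f' w‖ ^ 2
        + (E : ℝ) ^ 2 * σsq + (4 * Pn * B ^ 2 * (E : ℝ) ^ 2 / A ^ 2) * c := by
  have hA0 : A ≠ 0 := by positivity
  have hterm : ∀ e ∈ Finset.range E, ‖ζ e‖ ^ 2 ≤
      2 * Pn * B ^ 2 * ‖f' (wseq e) - f' w‖ ^ 2 + (2 * Pn * B ^ 2 * ‖f' w‖ ^ 2 + σsq) := by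
    intro e he
    have h := mul_le_mul_of_nonneg_left (norm_sq_le_two_mul_norm_sub_sq_add (f' (wseq e)) (f' w))
      (by positivity : 0 ≤ Pn * B ^ 2)
    linarith [hζ e he]
  calc ‖∑ e ∈ Finset.range E, ζ e‖ ^ 2
      ≤ (E : ℝ) * ∑ e ∈ Finset.range E, ‖ζ e‖ ^ 2 := by
        simpa using norm_sum_sq_le_card_mul_sum_norm_sq (Finset.range E) ζ
    _ ≤ (E : ℝ) * ∑ e ∈ Finset.range E, (2 * Pn * B ^ 2 * ‖f' (wseq e) - f' w‖ ^ 2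
          + (2 * Pn * B ^ 2 * ‖f' w‖ ^ 2 + σsq)) := by
        gcongr with e he
        exact hterm e he
    _ = 2 * Pn * B ^ 2 * ((E : ℝ) * ∑ e ∈ Finset.range E, ‖f' (wseq e) - f' w‖ ^ 2)
          + (E : ℝ) ^ 2 * (2 * Pn * B ^ 2 * ‖f' w‖ ^ 2 + σsq) := by
        rw [Finset.sum_add_distrib, ← Finset.mul_sum, Finset.sum_const, Finset.card_range,
          nsmul_eq_mul]
        ring
    _ ≤ 2 * Pn * B ^ 2 * ((2 * (E : ℝ) ^ 2 / A ^ 2) * (A * ‖f' w‖ ^ 2 + c))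
          + (E : ℝ) ^ 2 * (2 * Pn * B ^ 2 * ‖f' w‖ ^ 2 + σsq) := by
        gcongr
    _ = _ := by
        field_simp
        ring
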